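/- arXiv:1809.07180 — 8 statements merged into one kernel-verified Lean document; each statement's English description precedes it below -/
import Mathlib

section
/- Let H be a real inner product space, let T : H → H be continuous at θ ∈ H, let w ∈ H with Tθ ≠ w, and let Δ > 0. Then there exists ρ̄ > 0 such that for every ρ with 0 < ρ ≤ ρ̄, the backtracking trial point x = θ - ρ(Tθ - w) satisfies Δ‖θ - x‖² - ⟨θ - x, Tx - w⟩ ≤ 0. -/
open RealInnerProductSpace

theorem stmt_2 {H : Type*} [NormedAddCommGroup H] [InnerProductSpace ℝ H]
    (T : H → H) (θ w : H) (hT : ContinuousAt T θ) (hTw : T θ ≠ w)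
    (Δ : ℝ) (hΔ : 0 < Δ) :
    ∃ ρbar : ℝ, 0 < ρbar ∧ ∀ ρ : ℝ, 0 < ρ → ρ ≤ ρbar →
      Δ * ‖θ - (θ - ρ • (T θ - w))‖ ^ 2
        - ⟪θ - (θ - ρ • (T θ - w)), T (θ - ρ • (T θ - w)) - w⟫ ≤ 0 := by
  have hd : 0 < ‖T θ - w‖ := norm_pos_iff.mpr (sub_ne_zero.mpr hTw)
  have hcomp : ContinuousAt (fun ρ : ℝ => T (θ - ρ • (T θ - w))) 0 :=
    ContinuousAt.comp (g := T) (by simpa using hT) (by fun_prop)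
  have hcont : ContinuousAt (fun ρ : ℝ => Δ * (ρ * ‖T θ - w‖ ^ 2)
      - inner ℝ (T θ - w) (T (θ - ρ • (T θ - w)) - w)) 0 :=
    ContinuousAt.sub (by fun_prop)
      (ContinuousAt.inner (𝕜 := ℝ) continuousAt_const (hcomp.sub continuousAt_const))
  have hneg : ∀ᶠ ρ : ℝ in nhds 0, Δ * (ρ * ‖T θ - w‖ ^ 2)
      - inner ℝ (T θ - w) (T (θ - ρ • (T θ - w)) - w) < 0 := by
    refine hcont.eventually_lt continuousAt_const ?_
    simpa [real_inner_self_eq_norm_sq] using pow_pos hd 2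
  obtain ⟨ε, hε, hball⟩ := Metric.eventually_nhds_iff.mp hneg
  refine ⟨ε / 2, half_pos hε, fun ρ hρ hle => ?_⟩
  have hlt := hball (y := ρ) (by
    rw [Real.dist_eq, sub_zero, abs_of_pos hρ]
    linarith)
  rw [sub_sub_cancel, norm_smul, real_inner_smul_left, mul_pow, Real.norm_eq_abs, sq_abs]
  nlinarith [mul_pos hρ (neg_pos.mpr hlt)]
end

section
/- Let H be a real inner product space, let T : H → H be continuous at θ ∈ H, let w ∈ H with Tθ ≠ w, let Δ > 0, let ν ∈ (0,1), and let ρ₀ > 0. Then there exists j ∈ ℕ such that, with ρ = ν^j ρ₀ and backtracking trial point x = θ - ρ(Tθ - w), the termination criterion Δ‖θ - x‖² - ⟨θ - x, Tx - w⟩ ≤ 0 holds; i.e., the backtracking linesearch with initial stepsize ρ₀ and reduction factor ν terminates in finitely many iterations. -/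
open RealInnerProductSpace

theorem stmt_3 {H : Type*} [NormedAddCommGroup H] [InnerProductSpace ℝ H]
    (T : H → H) (θ w : H) (hT : ContinuousAt T θ) (hTw : T θ ≠ w)
    (Δ : ℝ) (hΔ : 0 < Δ) (ν : ℝ) (hν : ν ∈ Set.Ioo (0 : ℝ) 1)
    (ρ₀ : ℝ) (hρ₀ : 0 < ρ₀) :
    ∃ j : ℕ,
      Δ * ‖θ - (θ - (ν ^ j * ρ₀) • (T θ - w))‖ ^ 2
        - ⟪θ - (θ - (ν ^ j * ρ₀) • (T θ - w)),
            T (θ - (ν ^ j * ρ₀) • (T θ - w)) - w⟫ ≤ 0 := by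
  obtain ⟨hν0, hν1⟩ := hν
  have hu : 0 < ‖T θ - w‖ ^ 2 := by
    have : 0 < ‖T θ - w‖ := norm_pos_iff.mpr (sub_ne_zero.mpr hTw)
    positivity
  have hρ : Filter.Tendsto (fun j : ℕ => ν ^ j * ρ₀) Filter.atTop (nhds 0) := by
    simpa using (tendsto_pow_atTop_nhds_zero_of_lt_one hν0.le hν1).mul_const ρ₀
  have hx : Filter.Tendsto (fun j : ℕ => θ - (ν ^ j * ρ₀) • (T θ - w))
      Filter.atTop (nhds θ) := by
    simpa using (hρ.smul_const (T θ - w)).const_sub θ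
  have hlim : Filter.Tendsto
      (fun j : ℕ => Δ * (ν ^ j * ρ₀) * ‖T θ - w‖ ^ 2
        - ⟪T θ - w, T (θ - (ν ^ j * ρ₀) • (T θ - w)) - w⟫)
      Filter.atTop (nhds (Δ * 0 * ‖T θ - w‖ ^ 2 - ⟪T θ - w, T θ - w⟫)) :=
    ((hρ.const_mul Δ).mul_const _).sub
      (tendsto_const_nhds.inner ((hT.tendsto.comp hx).sub_const w))
  have hneg : Δ * 0 * ‖T θ - w‖ ^ 2 - ⟪T θ - w, T θ - w⟫ < 0 := by
    rw [real_inner_self_eq_norm_sq]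
    linarith
  obtain ⟨j, hj⟩ := (hlim.eventually_lt_const hneg).exists
  refine ⟨j, ?_⟩
  have hpos : 0 < ν ^ j * ρ₀ := by positivity
  rw [sub_sub_cancel, real_inner_smul_left, norm_smul, Real.norm_of_nonneg hpos.le]
  linarith [mul_neg_of_pos_of_neg hpos hj]
end

section
/- Let {Hᵢ}_{i∈I} be a finite family of real inner product spaces with index set I partitioned into disjoint subsets B and F. Fix σ ∈ [0,1), ρ̄ > 0, and Δ > 0. For each i ∈ B suppose ρᵢ ∈ (0, ρ̄] and aᵢ, xᵢ, yᵢ, wᵢ, eᵢ ∈ Hᵢ satisfy xᵢ + ρᵢyᵢ = aᵢ + ρᵢwᵢ + eᵢ and ⟨aᵢ - xᵢ, eᵢ⟩ ≥ -σ‖aᵢ - xᵢ‖². For each i ∈ F suppose aᵢ, xᵢ, yᵢ, wᵢ ∈ Hᵢ satisfy ⟨aᵢ - xᵢ, yᵢ - wᵢ⟩ ≥ Δ‖aᵢ - xᵢ‖². Then ∑_{i∈I} ⟨aᵢ - xᵢ, yᵢ - wᵢ⟩ ≥ min{(1 - σ)ρ̄⁻¹, Δ} · ∑_{i∈I} ‖aᵢ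 - xᵢ‖². -/
open RealInnerProductSpace

/-- An inexact proximal step with stepsize at most `ρbar` and relative error tolerance `σ` makes
progress at least `(1 - σ) / ρbar` times the squared displacement. -/
theorem inner_ge_of_inexact_prox_step {E : Type*} [NormedAddCommGroup E] [InnerProductSpace ℝ E]
    {σ ρ ρbar : ℝ} (hσ : σ ≤ 1) (hρ : 0 < ρ) (hρbar : ρ ≤ ρbar) {a x y w e : E}
    (hstep : x + ρ • y = a + ρ • w + e) (herr : -σ * ‖a - x‖ ^ 2 ≤ ⟪a - x, e⟫) :
    (1 - σ) * ρbar⁻¹ * ‖a - x‖ ^ 2 ≤ ⟪a - x, y - w⟫ := by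
  have hdiff : ρ • (y - w) = (a - x) + e := by
    rw [smul_sub, sub_eq_iff_eq_add, ← sub_eq_zero, ← sub_eq_zero.2 hstep]
    abel
  have hinner : ρ * ⟪a - x, y - w⟫ = ‖a - x‖ ^ 2 + ⟪a - x, e⟫ := by
    rw [← real_inner_smul_right, hdiff, inner_add_right, real_inner_self_eq_norm_sq]
  calc (1 - σ) * ρbar⁻¹ * ‖a - x‖ ^ 2
      ≤ (1 - σ) * ρ⁻¹ * ‖a - x‖ ^ 2 := by
        have : 0 ≤ 1 - σ := sub_nonneg.2 hσ
        gcongr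
    _ = ρ⁻¹ * ((1 - σ) * ‖a - x‖ ^ 2) := by ring
    _ ≤ ρ⁻¹ * (ρ * ⟪a - x, y - w⟫) := by
        refine mul_le_mul_of_nonneg_left ?_ (inv_nonneg.2 hρ.le)
        linarith
    _ = ⟪a - x, y - w⟫ := inv_mul_cancel_left₀ hρ.ne' _

theorem stmt_7 {I : Type*} [Fintype I] [DecidableEq I] (H : I → Type*)
    [∀ i, NormedAddCommGroup (H i)] [∀ i, InnerProductSpace ℝ (H i)]
    (B F : Finset I) (hdisj : Disjoint B F) (hunion : B ∪ F = Finset.univ)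
    (σ ρbar Δ : ℝ) (hσ : σ ∈ Set.Ico (0 : ℝ) 1) (hρbar : 0 < ρbar) (hΔ : 0 < Δ)
    (ρ : I → ℝ) (a x y w e : ∀ i, H i)
    (hB : ∀ i ∈ B, ρ i ∈ Set.Ioc (0 : ℝ) ρbar ∧
      x i + ρ i • y i = a i + ρ i • w i + e i ∧
      ⟪a i - x i, e i⟫ ≥ -σ * ‖a i - x i‖ ^ 2)
    (hF : ∀ i ∈ F, ⟪a i - x i, y i - w i⟫ ≥ Δ * ‖a i - x i‖ ^ 2) :
    ∑ i : I, ⟪a i - x i, y i - w i⟫ ≥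
      min ((1 - σ) * ρbar⁻¹) Δ * ∑ i : I, ‖a i - x i‖ ^ 2 := by
  rw [ge_iff_le, Finset.mul_sum]
  refine Finset.sum_le_sum fun i _ => ?_
  have hi : i ∈ B ∪ F := hunion ▸ Finset.mem_univ i
  rcases Finset.mem_union.1 hi with hi | hi
  · obtain ⟨hρ, hstep, herr⟩ := hB i hi
    exact (mul_le_mul_of_nonneg_right (min_le_left _ _) (sq_nonneg _)).trans
      (inner_ge_of_inexact_prox_step hσ.2.le hρ.1 hρ.2 hstep herr)
  · exact (mul_le_mul_of_nonneg_right (min_le_right _ _) (sq_nonneg _)).trans (hF i hi)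
end

section
/- Let {Hᵢ}_{i∈I} be a finite family of real inner product spaces with index set I partitioned into disjoint subsets B and F. Fix σ ∈ [0,1) and ρ_low > 0. For each i ∈ B suppose ρᵢ ≥ ρ_low and aᵢ, xᵢ, yᵢ, wᵢ, eᵢ ∈ Hᵢ satisfy xᵢ + ρᵢyᵢ = aᵢ + ρᵢwᵢ + eᵢ and ⟨eᵢ, yᵢ - wᵢ⟩ ≤ ρᵢσ‖yᵢ - wᵢ‖². For each i ∈ F suppose Tᵢ : Hᵢ → Hᵢ is a map, ρᵢ > 0, and xᵢ = aᵢ - ρᵢ(Tᵢaᵢ - wᵢ), yᵢ = Tᵢxᵢ. Then ∑_{i∈I} ⟨aᵢ - xᵢ, yᵢ - wᵢ⟩ + ∑_{i∈F} ⟨xᵢ - aᵢ, Tᵢxᵢ - Tᵢaᵢ⟩ ≥ (1 - σ)ρ_low · ∑_{i∈B} ‖yᵢ - wᵢ‖². -/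
open RealInnerProductSpace

/-- An inexact backward step with relative error tolerance `σ` separates by at least
`(1 - σ) * ρ * ‖y - w‖ ^ 2`. -/
theorem le_inner_of_inexact_backward_step {E : Type*} [NormedAddCommGroup E]
    [InnerProductSpace ℝ E] {σ ρ : ℝ} {a x y w e : E}
    (hstep : x + ρ • y = a + ρ • w + e)
    (herr : ⟪e, y - w⟫ ≤ ρ * σ * ‖y - w‖ ^ 2) :
    (1 - σ) * ρ * ‖y - w‖ ^ 2 ≤ ⟪a - x, y - w⟫ := by
  have hax : a - x = ρ • (y - w) - e := by
    rw [smul_sub, sub_eq_iff_eq_add, eq_sub_of_add_eq hstep]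
    abel
  rw [hax, inner_sub_left, real_inner_smul_left, real_inner_self_eq_norm_sq]
  linarith

/-- For a forward step `x = a - ρ • (u - w)`, the displacement `a - x` correlates with
`v - w` at least as much as with `v - u`. -/
theorem inner_add_inner_nonneg_of_forward_step {E : Type*} [NormedAddCommGroup E]
    [InnerProductSpace ℝ E] {ρ : ℝ} (hρ : 0 ≤ ρ) {a x u w : E} (v : E)
    (hstep : x = a - ρ • (u - w)) :
    0 ≤ ⟪a - x, v - w⟫ + ⟪x - a, v - u⟫ := by
  have hsum : ⟪a - x, v - w⟫ + ⟪x - a, v - u⟫ = ⟪a - x, u - w⟫ := by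
    rw [← neg_sub a x, inner_neg_left, ← sub_eq_add_neg, ← inner_sub_right,
      sub_sub_sub_cancel_left]
  rw [hsum, hstep, sub_sub_cancel, real_inner_smul_left]
  exact mul_nonneg hρ real_inner_self_nonneg

theorem stmt_8 {I : Type*} [Fintype I] [DecidableEq I] (H : I → Type*)
    [∀ i, NormedAddCommGroup (H i)] [∀ i, InnerProductSpace ℝ (H i)]
    (B F : Finset I) (hdisj : Disjoint B F) (hunion : B ∪ F = Finset.univ)
    (σ ρlow : ℝ) (hσ : σ ∈ Set.Ico (0 : ℝ) 1) (hρlow : 0 < ρlow)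
    (ρ : I → ℝ) (a x y w e : ∀ i, H i) (T : ∀ i, H i → H i)
    (hB : ∀ i ∈ B, ρ i ≥ ρlow ∧
      x i + ρ i • y i = a i + ρ i • w i + e i ∧
      ⟪e i, y i - w i⟫ ≤ ρ i * σ * ‖y i - w i‖ ^ 2)
    (hF : ∀ i ∈ F, 0 < ρ i ∧
      x i = a i - ρ i • (T i (a i) - w i) ∧ y i = T i (x i)) :
    ∑ i : I, ⟪a i - x i, y i - w i⟫
      + ∑ i ∈ F, ⟪x i - a i, T i (x i) - T i (a i)⟫ ≥
      (1 - σ) * ρlow * ∑ i ∈ B, ‖y i - w i‖ ^ 2 := by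
  have hBsum : (1 - σ) * ρlow * ∑ i ∈ B, ‖y i - w i‖ ^ 2 ≤
      ∑ i ∈ B, ⟪a i - x i, y i - w i⟫ := by
    rw [Finset.mul_sum]
    refine Finset.sum_le_sum fun i hi => ?_
    obtain ⟨hρ, hstep, herr⟩ := hB i hi
    refine le_trans ?_ (le_inner_of_inexact_backward_step hstep herr)
    have hσ' : 0 ≤ 1 - σ := sub_nonneg.2 hσ.2.le
    gcongr
  have hFsum : 0 ≤ ∑ i ∈ F, ⟪a i - x i, y i - w i⟫ +
      ∑ i ∈ F, ⟪x i - a i, T i (x i) - T i (a i)⟫ := by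
    rw [← Finset.sum_add_distrib]
    refine Finset.sum_nonneg fun i hi => ?_
    obtain ⟨hρ, hstep, hy⟩ := hF i hi
    rw [hy]
    exact inner_add_inner_nonneg_of_forward_step hρ.le _ hstep
  rw [← hunion, Finset.sum_union hdisj]
  linarith
end

section
/- Let H be a real inner product space, let C ⊆ H, let T : H → H, and let θ, w ∈ H, ε > 0, δ > 0, Δ > 0, B > 0. Suppose: (i) for all u, v ∈ C with ‖u - v‖ ≤ δ one has ‖Tu - Tv‖ ≤ ε/4; (ii) ε/2 < ‖Tθ - w‖ ≤ B; (iii) 0 < ρ ≤ min{ε/(4BΔ), δ/B}; and (iv) θ ∈ C and the backtracking trial point x = θ - ρ(Tθ - w) lies in C. Then ⟨θ - x, Tx - w⟩ > Δ‖θ - x‖², i.e., the backtracking termination criterion holds strictly at stepsize ρ. -/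
open RealInnerProductSpace

theorem stmt_9 {H : Type*} [NormedAddCommGroup H] [InnerProductSpace ℝ H]
    (C : Set H) (T : H → H) (θ w : H) (ε δ Δ B ρ : ℝ)
    (hε : 0 < ε) (hδ : 0 < δ) (hΔ : 0 < Δ) (hB : 0 < B)
    (huc : ∀ u ∈ C, ∀ v ∈ C, ‖u - v‖ ≤ δ → ‖T u - T v‖ ≤ ε / 4)
    (hlow : ε / 2 < ‖T θ - w‖) (hup : ‖T θ - w‖ ≤ B)
    (hρpos : 0 < ρ) (hρle : ρ ≤ min (ε / (4 * B * Δ)) (δ / B))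
    (x : H) (hx : x = θ - ρ • (T θ - w))
    (hθC : θ ∈ C) (hxC : x ∈ C) :
    ⟪θ - x, T x - w⟫ > Δ * ‖θ - x‖ ^ 2 := by
  obtain ⟨hρ₁, hρ₂⟩ := le_min_iff.mp hρle
  rw [le_div_iff₀ (by positivity)] at hρ₁
  rw [le_div_iff₀ hB] at hρ₂
  have hstep : θ - x = ρ • (T θ - w) := by rw [hx]; abel
  have hnorm : ‖θ - x‖ = ρ * ‖T θ - w‖ := by
    rw [hstep, norm_smul, Real.norm_of_nonneg hρpos.le]
  have hle : ‖θ - x‖ ≤ δ := by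
    rw [hnorm]
    exact (mul_le_mul_of_nonneg_left hup hρpos.le).trans hρ₂
  have hT := huc θ hθC x hxC hle
  have hsplit : T x - w = (T θ - w) - (T θ - T x) := by abel
  have hinner : ⟪T θ - w, T θ - T x⟫ ≤ ‖T θ - w‖ * (ε / 4) :=
    (real_inner_le_norm _ _).trans (mul_le_mul_of_nonneg_left hT (norm_nonneg _))
  have hg : 0 < ‖T θ - w‖ := by linarith
  have hsmall : Δ * ρ * ‖T θ - w‖ ≤ ε / 4 := by
    have := mul_le_mul_of_nonneg_left hup (mul_pos hΔ hρpos).le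
    linarith
  rw [hnorm, hstep, real_inner_smul_left, hsplit, inner_sub_right, real_inner_self_eq_norm_sq]
  calc Δ * (ρ * ‖T θ - w‖) ^ 2
      = ρ * (‖T θ - w‖ * (Δ * ρ * ‖T θ - w‖)) := by ring
    _ ≤ ρ * (‖T θ - w‖ * (ε / 4)) := by gcongr
    _ < ρ * (‖T θ - w‖ * (‖T θ - w‖ - ε / 4)) := by gcongr; linarith
    _ ≤ ρ * (‖T θ - w‖ ^ 2 - ⟪T θ - w, T θ - T x⟫) := by gcongr; linarith
end

section
/- Let H be a real inner product space, let C ⊆ H, let T : H → H, and let θ, w ∈ H with Tθ ≠ w. Let ε > 0, δ > 0, Δ > 0, B > 0, ν ∈ (0,1), ρ₀ > 0. Suppose: (i) for all u, v ∈ C with ‖u - v‖ ≤ δ one has ‖Tu - Tv‖ ≤ ε/4; (ii) ε/2 < ‖Tθ - w‖ ≤ B; (iii) θ ∈ C and for every j ∈ ℕ the trial point θ - ν^j ρ₀ (Tθ - w) lies in C. Let ĵ be the smallest natural number j such that, with x = θ - ν^j ρ₀ (Tθ - w), the termination criterion ⟨θ - x, Tx - w⟩ ≥ Δ‖θ - x‖²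 holds (ĵ exists). Then the accepted stepsize ρ̂ = ν^{ĵ} ρ₀ satisfies ρ̂ ≥ min{νε/(4BΔ), νδ/B, ρ₀}. -/
open RealInnerProductSpace

/-- If `T` moves by at most `ε / 4` along a step of length `ρ`, and `ρ * Δ * ‖T θ - w‖ ≤ ε / 4`, then
the trial point satisfies the termination criterion. -/
theorem backtracking_criterion_of_small_step {H : Type*} [NormedAddCommGroup H]
    [InnerProductSpace ℝ H] {T : H → H} {θ w : H} {ε Δ ρ : ℝ} (hρ : 0 ≤ ρ)
    (hlow : ε / 2 ≤ ‖T θ - w‖) (hstep : ρ * Δ * ‖T θ - w‖ ≤ ε / 4)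
    (hT : ‖T (θ - ρ • (T θ - w)) - T θ‖ ≤ ε / 4) :
    Δ * ‖θ - (θ - ρ • (T θ - w))‖ ^ 2 ≤
      ⟪θ - (θ - ρ • (T θ - w)), T (θ - ρ • (T θ - w)) - w⟫ := by
  set F := T θ - w with hF
  set x := θ - ρ • F
  have hinner : ⟪F, T x - w⟫ = ‖F‖ ^ 2 + ⟪F, T x - T θ⟫ := by
    rw [← real_inner_self_eq_norm_sq, ← inner_add_right, hF]
    congr 1
    abel
  have hcs : -(‖F‖ * (ε / 4)) ≤ ⟪F, T x - T θ⟫ :=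
    (neg_le_neg (mul_le_mul_of_nonneg_left hT (norm_nonneg F))).trans
      (neg_le_of_abs_le (abs_real_inner_le_norm F (T x - T θ)))
  have hdiff : θ - x = ρ • F := sub_sub_cancel θ (ρ • F)
  rw [hdiff, real_inner_smul_left, norm_smul, Real.norm_of_nonneg hρ, hinner]
  have hnorm : ‖F‖ * (ρ * Δ * ‖F‖) ≤ ‖F‖ * (‖F‖ - ε / 4) :=
    mul_le_mul_of_nonneg_left (by linarith) (norm_nonneg F)
  calc Δ * (ρ * ‖F‖) ^ 2 = ρ * (‖F‖ * (ρ * Δ * ‖F‖)) := by ring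
    _ ≤ ρ * (‖F‖ ^ 2 + ⟪F, T x - T θ⟫) := mul_le_mul_of_nonneg_left (by linarith) hρ

theorem stmt_10 {H : Type*} [NormedAddCommGroup H] [InnerProductSpace ℝ H]
    (C : Set H) (T : H → H) (θ w : H) (hTw : T θ ≠ w)
    (ε δ Δ B ν ρ₀ : ℝ)
    (hε : 0 < ε) (hδ : 0 < δ) (hΔ : 0 < Δ) (hB : 0 < B)
    (hν : ν ∈ Set.Ioo (0 : ℝ) 1) (hρ₀ : 0 < ρ₀)
    (huc : ∀ u ∈ C, ∀ v ∈ C, ‖u - v‖ ≤ δ → ‖T u - T v‖ ≤ ε / 4)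
    (hlow : ε / 2 < ‖T θ - w‖) (hup : ‖T θ - w‖ ≤ B)
    (hθC : θ ∈ C) (htrialC : ∀ j : ℕ, θ - (ν ^ j * ρ₀) • (T θ - w) ∈ C)
    (jhat : ℕ)
    (hterm : ⟪θ - (θ - (ν ^ jhat * ρ₀) • (T θ - w)),
        T (θ - (ν ^ jhat * ρ₀) • (T θ - w)) - w⟫ ≥
      Δ * ‖θ - (θ - (ν ^ jhat * ρ₀) • (T θ - w))‖ ^ 2)
    (hleast : ∀ j : ℕ, j < jhat →
      ¬ (⟪θ - (θ - (ν ^ j * ρ₀) • (T θ - w)),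
          T (θ - (ν ^ j * ρ₀) • (T θ - w)) - w⟫ ≥
        Δ * ‖θ - (θ - (ν ^ j * ρ₀) • (T θ - w))‖ ^ 2)) :
    ν ^ jhat * ρ₀ ≥ min (ν * ε / (4 * B * Δ)) (min (ν * δ / B) ρ₀) := by
  obtain _ | j := jhat
  · simp
  by_contra! hlt
  obtain ⟨hε', hδρ, -⟩ := by simpa only [lt_min_iff] using hlt
  set ρ := ν ^ j * ρ₀
  have hρ : 0 ≤ ρ := mul_nonneg (pow_nonneg hν.1.le j) hρ₀.le
  have hsucc : ν ^ (j + 1) * ρ₀ = ν * ρ := by simp only [ρ]; ring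
  rw [hsucc, mul_div_assoc, mul_lt_mul_iff_right₀ hν.1] at hε' hδρ
  rw [lt_div_iff₀ (by positivity)] at hε'
  rw [lt_div_iff₀ hB] at hδρ
  have hρB : ρ * ‖T θ - w‖ ≤ ρ * B := mul_le_mul_of_nonneg_left hup hρ
  refine hleast j j.lt_succ_self
    (backtracking_criterion_of_small_step hρ hlow.le ?_ (huc _ (htrialC j) _ hθC ?_))
  · linarith [mul_le_mul_of_nonneg_left hρB hΔ.le]
  · rw [sub_sub_cancel_left, norm_neg, norm_smul, Real.norm_of_nonneg hρ]
    exact hρB.trans hδρ.le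
end

section
/- Let H be a real inner product space, let C ⊆ H, let T : H → H, and let θ, w ∈ H with Tθ ≠ w. Let ε > 0, δ > 0, Δ > 0, B > 0, ν ∈ (0,1), and ρ₀ ≥ ρ_low > 0. Suppose: (i) for all u, v ∈ C with ‖u - v‖ ≤ δ one has ‖Tu - Tv‖ ≤ ε/4; (ii) ‖Tθ - w‖ ≤ B; (iii) θ ∈ C and for every j ∈ ℕ the trial point θ - ν^j ρ₀ (Tθ - w) lies in C. Let ρ̂ be the stepsize accepted by the backtracking linesearch (with parameter Δ, initial stepsize ρ₀, reduction factor ν) and let x̂ = θ - ρ̂(Tθ - w). If ‖x̂ - θ‖ ≤ ε · min{νε/(4BΔ), νδ/B, ρ_low}, then ‖Tθ - w‖ ≤ ε. -/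
open RealInnerProductSpace

/-- The linesearch criterion holds at a step `ρ` along `-g` whenever the residual `y` at the trial
point is within `ε / 4` of `g`, `‖g‖` is at least `ε`, and `Δ * ρ * ‖g‖ ≤ ε / 4`. -/
theorem le_inner_smul_of_norm_sub_le {H : Type*} [NormedAddCommGroup H] [InnerProductSpace ℝ H]
    {g y : H} {ε Δ ρ : ℝ} (hρ : 0 ≤ ρ) (hg : ε ≤ ‖g‖)
    (hy : ‖y - g‖ ≤ ε / 4) (hstep : Δ * ρ * ‖g‖ ≤ ε / 4) :
    Δ * ‖ρ • g‖ ^ 2 ≤ ⟪ρ • g, y⟫ := by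
  have hcs : -(‖g‖ * ‖y - g‖) ≤ ⟪g, y - g⟫ :=
    (abs_le.mp (abs_real_inner_le_norm g (y - g))).1
  have hsplit : ⟪g, y⟫ = ‖g‖ ^ 2 + ⟪g, y - g⟫ := by
    rw [inner_sub_right, real_inner_self_eq_norm_sq]
    ring
  have hbound : Δ * ρ * ‖g‖ ^ 2 ≤ ⟪g, y⟫ := by
    nlinarith [mul_le_mul_of_nonneg_left hy (norm_nonneg g),
      mul_le_mul_of_nonneg_left hstep (norm_nonneg g),
      mul_le_mul_of_nonneg_left hg (norm_nonneg g),
      mul_nonneg (norm_nonneg g) (norm_nonneg (y - g))]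
  rw [norm_smul, Real.norm_of_nonneg hρ, real_inner_smul_left]
  calc Δ * (ρ * ‖g‖) ^ 2 = ρ * (Δ * ρ * ‖g‖ ^ 2) := by ring
    _ ≤ ρ * ⟪g, y⟫ := mul_le_mul_of_nonneg_left hbound hρ

theorem stmt_11 {H : Type*} [NormedAddCommGroup H] [InnerProductSpace ℝ H]
    (C : Set H) (T : H → H) (θ w : H) (hTw : T θ ≠ w)
    (ε δ Δ B ν ρ₀ ρlow : ℝ)
    (hε : 0 < ε) (hδ : 0 < δ) (hΔ : 0 < Δ) (hB : 0 < B)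
    (hν : ν ∈ Set.Ioo (0 : ℝ) 1) (hρlow : 0 < ρlow) (hρ₀ : ρlow ≤ ρ₀)
    (huc : ∀ u ∈ C, ∀ v ∈ C, ‖u - v‖ ≤ δ → ‖T u - T v‖ ≤ ε / 4)
    (hup : ‖T θ - w‖ ≤ B)
    (hθC : θ ∈ C) (htrialC : ∀ j : ℕ, θ - (ν ^ j * ρ₀) • (T θ - w) ∈ C)
    (jhat : ℕ)
    (hterm : ⟪θ - (θ - (ν ^ jhat * ρ₀) • (T θ - w)),
        T (θ - (ν ^ jhat * ρ₀) • (T θ - w)) - w⟫ ≥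
      Δ * ‖θ - (θ - (ν ^ jhat * ρ₀) • (T θ - w))‖ ^ 2)
    (hleast : ∀ j : ℕ, j < jhat →
      ¬ (⟪θ - (θ - (ν ^ j * ρ₀) • (T θ - w)),
          T (θ - (ν ^ j * ρ₀) • (T θ - w)) - w⟫ ≥
        Δ * ‖θ - (θ - (ν ^ j * ρ₀) • (T θ - w))‖ ^ 2))
    (ρhat : ℝ) (hρhat : ρhat = ν ^ jhat * ρ₀)
    (xhat : H) (hxhat : xhat = θ - ρhat • (T θ - w))
    (hsmall : ‖xhat - θ‖ ≤
      ε * min (ν * ε / (4 * B * Δ)) (min (ν * δ / B) ρlow)) :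
    ‖T θ - w‖ ≤ ε := by
  obtain ⟨hν0, -⟩ := hν
  by_contra! hlt
  have hρ₀pos : 0 < ρ₀ := hρlow.trans_le hρ₀
  have hρpos : 0 < ρhat := hρhat ▸ mul_pos (pow_pos hν0 _) hρ₀pos
  have hnorm : ‖xhat - θ‖ = ρhat * ‖T θ - w‖ := by
    rw [hxhat, sub_sub_cancel_left, norm_neg, norm_smul, Real.norm_of_nonneg hρpos.le]
  have hmin : ρhat < min (ν * ε / (4 * B * Δ)) (min (ν * δ / B) ρlow) := by
    rw [hnorm] at hsmall
    refine lt_of_mul_lt_mul_left ?_ hε.le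
    nlinarith [mul_lt_mul_of_pos_left hlt hρpos]
  obtain ⟨hρε, hmin'⟩ := lt_min_iff.mp hmin
  obtain ⟨hρδ, hρl⟩ := lt_min_iff.mp hmin'
  rw [lt_div_iff₀ (by positivity)] at hρε
  rw [lt_div_iff₀ hB] at hρδ
  cases jhat with
  | zero =>
    rw [pow_zero, one_mul] at hρhat
    linarith
  | succ j =>
    apply hleast j j.lt_succ_self
    have hC := htrialC j
    have hρj : 0 < ν ^ j * ρ₀ := mul_pos (pow_pos hν0 _) hρ₀pos
    have hρν : ρhat = ν * (ν ^ j * ρ₀) := by rw [hρhat, pow_succ']; ring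
    generalize ν ^ j * ρ₀ = ρ at hC hρj hρν ⊢
    subst hρν
    have hδ' : ρ * B < δ := lt_of_mul_lt_mul_left (by linarith) hν0.le
    have hε' : ρ * (4 * B * Δ) < ε := lt_of_mul_lt_mul_left (by linarith) hν0.le
    have hdist : ‖θ - ρ • (T θ - w) - θ‖ ≤ δ := by
      rw [sub_sub_cancel_left, norm_neg, norm_smul, Real.norm_of_nonneg hρj.le]
      exact (mul_le_mul_of_nonneg_left hup hρj.le).trans hδ'.le
    have hT := huc _ hC _ hθC hdist
    rw [sub_sub_cancel]
    refine le_inner_smul_of_norm_sub_le hρj.le hlt.le ?_ ?_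
    · rwa [sub_sub_sub_cancel_right]
    · linarith [mul_le_mul_of_nonneg_left hup (mul_pos hΔ hρj).le]
end

section
/- Let H be a finite-dimensional real inner product space and let T : H → H be continuous. Fix Δ > 0, ν ∈ (0,1), and 0 < ρ_low ≤ ρ_high. Let {θ_k} and {w_k} be bounded sequences in H and let {ρ_k} be a sequence of initial stepsizes with ρ_k ∈ [ρ_low, ρ_high] for all k. For each k define: if Tθ_k = w_k, set x_k = θ_k; otherwise let ρ̂_k = ν^{j_k} ρ_k, where j_k is the smallest natural number j such that the trial point x = θ_k - ν^j ρ_k (Tθ_k - w_k) satisfies ⟨θ_k - x, Tx - w_k⟩ ≥ Δ‖θ_k - x‖², and set x_k = θ_k - ρ̂_k(Tθ_k - w_k). If x_k - θ_k → 0 as k → ∞, then Tθ_k - w_k → 0 and Tx_k - w_k → 0. -/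
open RealInnerProductSpace Filter

/-- A continuous map on a proper space preserves asymptotic equality with a bounded sequence. -/
theorem tendsto_sub_comp_of_bounded {E F : Type*} [NormedAddCommGroup E] [ProperSpace E]
    [NormedAddCommGroup F] {T : E → F} (hT : Continuous T) {θ z : ℕ → E}
    (hθ : ∃ M : ℝ, ∀ k, ‖θ k‖ ≤ M) (hz : Tendsto (fun k => z k - θ k) atTop (nhds 0)) :
    Tendsto (fun k => T (z k) - T (θ k)) atTop (nhds 0) := by
  obtain ⟨M, hM⟩ := hθ
  rw [Metric.tendsto_atTop] at hz ⊢
  intro ε hε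
  have hU := (isCompact_closedBall (0 : E) M).uniformContinuousAt_of_continuousAt T
    (fun a _ => hT.continuousAt) (Metric.dist_mem_uniformity hε)
  obtain ⟨δ, hδ, h⟩ := Metric.mem_uniformity_dist.1 hU
  obtain ⟨N, hN⟩ := hz δ hδ
  refine ⟨N, fun k hk => ?_⟩
  have h1 : dist (θ k) (z k) < δ := by
    simpa [dist_eq_norm, norm_sub_rev] using hN k hk
  have h2 := h h1 (by simpa using hM k)
  simpa [dist_eq_norm, norm_sub_rev] using h2

/-- If a step of size `t > 0` from `a` along `-(T a - w)` violates the linesearch criterion,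
then the residual at `a` is controlled by the step and the variation of `T` along it. -/
theorem norm_residual_le_of_criterion_fails {H : Type*} [NormedAddCommGroup H]
    [InnerProductSpace ℝ H] {T : H → H} {Δ t : ℝ} (ht : 0 < t) {a w z : H}
    (hz : z = a - t • (T a - w)) (hfail : ¬ (⟪a - z, T z - w⟫ ≥ Δ * ‖a - z‖ ^ 2)) :
    ‖T a - w‖ ≤ Δ * ‖z - a‖ + ‖T z - T a‖ := by
  have haz : a - z = t • (T a - w) := by rw [hz]; abel
  rw [norm_sub_rev z a]
  have hTz : T z - w = (T a - w) + (T z - T a) := by abel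
  rw [hTz, haz, inner_smul_left, inner_add_right, real_inner_self_eq_norm_sq, norm_smul,
    Real.norm_of_nonneg ht.le, not_le] at hfail
  rw [haz, norm_smul, Real.norm_of_nonneg ht.le]
  have hcs := neg_le_of_abs_le (abs_real_inner_le_norm (T a - w) (T z - T a))
  simp only [conj_trivial] at hfail
  have h1 : ‖T a - w‖ ^ 2 + ⟪T a - w, T z - T a⟫ < Δ * t * ‖T a - w‖ ^ 2 := by
    refine lt_of_mul_lt_mul_left ?_ ht.le
    linarith
  by_contra! hlt
  nlinarith [mul_le_mul_of_nonneg_left hlt.le (norm_nonneg (T a - w))]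

theorem stmt_12 {H : Type*} [NormedAddCommGroup H] [InnerProductSpace ℝ H]
    [FiniteDimensional ℝ H]
    (T : H → H) (hT : Continuous T)
    (Δ ν ρlow ρhigh : ℝ) (hΔ : 0 < Δ) (hν : ν ∈ Set.Ioo (0 : ℝ) 1)
    (hρlow : 0 < ρlow) (hρ : ρlow ≤ ρhigh)
    (θ w : ℕ → H)
    (hθbdd : ∃ M : ℝ, ∀ k, ‖θ k‖ ≤ M) (hwbdd : ∃ M : ℝ, ∀ k, ‖w k‖ ≤ M)
    (ρ : ℕ → ℝ) (hρk : ∀ k, ρ k ∈ Set.Icc ρlow ρhigh)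
    (x : ℕ → H)
    (hx : ∀ k, (T (θ k) = w k ∧ x k = θ k) ∨
      (T (θ k) ≠ w k ∧ ∃ j : ℕ,
        (⟪θ k - (θ k - (ν ^ j * ρ k) • (T (θ k) - w k)),
            T (θ k - (ν ^ j * ρ k) • (T (θ k) - w k)) - w k⟫ ≥
          Δ * ‖θ k - (θ k - (ν ^ j * ρ k) • (T (θ k) - w k))‖ ^ 2) ∧
        (∀ j' : ℕ, j' < j →
          ¬ (⟪θ k - (θ k - (ν ^ j' * ρ k) • (T (θ k) - w k)),
              T (θ k - (ν ^ j' * ρ k) • (T (θ k) - w k)) - w k⟫ ≥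
            Δ * ‖θ k - (θ k - (ν ^ j' * ρ k) • (T (θ k) - w k))‖ ^ 2)) ∧
        x k = θ k - (ν ^ j * ρ k) • (T (θ k) - w k)))
    (hconv : Tendsto (fun k => x k - θ k) atTop (nhds 0)) :
    Tendsto (fun k => T (θ k) - w k) atTop (nhds 0) ∧
      Tendsto (fun k => T (x k) - w k) atTop (nhds 0) := by
  obtain ⟨hν0, hν1⟩ := hν
  have key : ∀ k, ∃ z : H, ‖z - θ k‖ ≤ ν⁻¹ * ‖x k - θ k‖ ∧
      ‖T (θ k) - w k‖ ≤ (ρlow⁻¹ + Δ * ν⁻¹) * ‖x k - θ k‖ + ‖T z - T (θ k)‖ := by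
    intro k
    have hρ0 : 0 < ρ k := hρlow.trans_le (hρk k).1
    rcases hx k with ⟨h1, h2⟩ | ⟨-, j, -, hmin, hxk⟩
    · exact ⟨θ k, by simp [h2], by simp [h1, h2]⟩
    have hstep : ‖x k - θ k‖ = ν ^ j * ρ k * ‖T (θ k) - w k‖ := by
      rw [hxk, sub_sub_cancel_left, norm_neg, norm_smul, Real.norm_of_nonneg (by positivity)]
    rcases j with _ | j
    · refine ⟨θ k, by simp; positivity, ?_⟩
      have h1 : ρlow * ‖T (θ k) - w k‖ ≤ ‖x k - θ k‖ := by
        rw [hstep, pow_zero, one_mul]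
        exact mul_le_mul_of_nonneg_right (hρk k).1 (norm_nonneg _)
      have h2 : ‖T (θ k) - w k‖ ≤ ρlow⁻¹ * ‖x k - θ k‖ := (le_inv_mul_iff₀ hρlow).2 h1
      have h3 : 0 ≤ Δ * ν⁻¹ * ‖x k - θ k‖ := by positivity
      rw [sub_self, norm_zero]
      linarith
    · set z := θ k - (ν ^ j * ρ k) • (T (θ k) - w k) with hz
      have hzn : ‖z - θ k‖ = ν⁻¹ * ‖x k - θ k‖ := by
        rw [hstep, hz, sub_sub_cancel_left, norm_neg, norm_smul,
          Real.norm_of_nonneg (by positivity), pow_succ]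
        field_simp
      have hres := norm_residual_le_of_criterion_fails (by positivity) hz
        (hmin j (Nat.lt_succ_self j))
      refine ⟨z, hzn.le, ?_⟩
      have h3 : 0 ≤ ρlow⁻¹ * ‖x k - θ k‖ := by positivity
      rw [hzn] at hres
      linarith
  choose z hz hres using key
  have hnorm : Tendsto (fun k => ‖x k - θ k‖) atTop (nhds 0) := by simpa using hconv.norm
  have hzθ : Tendsto (fun k => z k - θ k) atTop (nhds 0) :=
    squeeze_zero_norm hz (by simpa using hnorm.const_mul ν⁻¹)
  have hθw : Tendsto (fun k => T (θ k) - w k) atTop (nhds 0) :=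
    squeeze_zero_norm hres (by
      simpa using (hnorm.const_mul (ρlow⁻¹ + Δ * ν⁻¹)).add
        (tendsto_sub_comp_of_bounded hT hθbdd hzθ).norm)
  refine ⟨hθw, ?_⟩
  simpa using (tendsto_sub_comp_of_bounded hT hθbdd hconv).add hθw
end
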